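/- Let A = kQ/I be a gentle one-cycle algebra whose unique cycle 𝒞 = a_1⋯a_l (with s(a_i) = i) is a full-relational oriented cycle, and let 1 ≤ t ≤ l. Then 𝔢_{𝒞,t}(T_{𝒞,t}(a_tA)), i.e. the projective right Ā_{𝒞,t}-module ε̄_{t(a_t)}Ā_{𝒞,t} viewed as a right A-module, is isomorphic to a_tA; in particular it is a non-projective indecomposable G-projective right A-module. -/

import Mathlib

/- Common infrastructure: finite quivers, path algebras, gentle algebras,
   right modules, Gorenstein projective modules, etc. -/

open MulOpposite

noncomputable section

/-- A finite quiver, with `nV` vertices and `nE` arrows. -/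
structure QuiverData where
  nV : ℕ
  nE : ℕ
  src : Fin nE → Fin nV
  tgt : Fin nE → Fin nV

/-- The relations defining the path algebra `kQ` as a quotient of the free
algebra on the set of vertices and arrows:  the trivial paths `e_v` are
orthogonal idempotents summing to `1`, and `e_{s(a)} * a = a = a * e_{t(a)}`.
(Paths are composed left-to-right, matching the paper's convention.) -/
inductive PathRel (k : Type) [Field k] (Q : QuiverData) :
    FreeAlgebra k (Fin Q.nV ⊕ Fin Q.nE) → FreeAlgebra k (Fin Q.nV ⊕ Fin Q.nE) → Prop
  | vtx_mul (v w : Fin Q.nV) : PathRel k Q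
      (FreeAlgebra.ι k (Sum.inl v) * FreeAlgebra.ι k (Sum.inl w))
      (if v = w then FreeAlgebra.ι k (Sum.inl v) else 0)
  | vtx_sum : PathRel k Q (∑ v : Fin Q.nV, FreeAlgebra.ι k (Sum.inl v)) 1
  | src_arr (e : Fin Q.nE) : PathRel k Q
      (FreeAlgebra.ι k (Sum.inl (Q.src e)) * FreeAlgebra.ι k (Sum.inr e))
      (FreeAlgebra.ι k (Sum.inr e))
  | arr_tgt (e : Fin Q.nE) : PathRel k Q
      (FreeAlgebra.ι k (Sum.inr e) * FreeAlgebra.ι k (Sum.inl (Q.tgt e)))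
      (FreeAlgebra.ι k (Sum.inr e))

/-- The path algebra `kQ`. -/
def PathAlg (k : Type) [Field k] (Q : QuiverData) := RingQuot (PathRel k Q)

instance (k : Type) [Field k] (Q : QuiverData) : Ring (PathAlg k Q) :=
  inferInstanceAs (Ring (RingQuot (PathRel k Q)))

instance (k : Type) [Field k] (Q : QuiverData) : Algebra k (PathAlg k Q) :=
  inferInstanceAs (Algebra k (RingQuot (PathRel k Q)))

/-- The arrow `e`, as an element of the path algebra. -/
def arr (k : Type) [Field k] (Q : QuiverData) (e : Fin Q.nE) : PathAlg k Q :=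
  RingQuot.mkAlgHom k (PathRel k Q) (FreeAlgebra.ι k (Sum.inr e))

/-- The trivial path (idempotent) at the vertex `v`, in the path algebra. -/
def vtx (k : Type) [Field k] (Q : QuiverData) (v : Fin Q.nV) : PathAlg k Q :=
  RingQuot.mkAlgHom k (PathRel k Q) (FreeAlgebra.ι k (Sum.inl v))

/-- Given a set `Rel` of (composable) pairs of arrows, the relation on `kQ`
identifying each corresponding length-two path with `0`; the quotient is
`kQ/I` where `I` is the two-sided ideal generated by these paths of length two. -/
def GRel (k : Type) [Field k] (Q : QuiverData) (Rel : Set (Fin Q.nE × Fin Q.nE)) :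
    PathAlg k Q → PathAlg k Q → Prop := fun x y =>
  (∃ p ∈ Rel, x = arr k Q p.1 * arr k Q p.2) ∧ y = 0

/-- The algebra `A = kQ/I`. -/
def GAlg (k : Type) [Field k] (Q : QuiverData) (Rel : Set (Fin Q.nE × Fin Q.nE)) :=
  RingQuot (GRel k Q Rel)

instance (k : Type) [Field k] (Q : QuiverData) (Rel : Set (Fin Q.nE × Fin Q.nE)) :
    Ring (GAlg k Q Rel) := inferInstanceAs (Ring (RingQuot (GRel k Q Rel)))

instance (k : Type) [Field k] (Q : QuiverData) (Rel : Set (Fin Q.nE × Fin Q.nE)) :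
    Algebra k (GAlg k Q Rel) := inferInstanceAs (Algebra k (RingQuot (GRel k Q Rel)))

/-- The canonical projection `kQ → kQ/I`. -/
def gmap (k : Type) [Field k] (Q : QuiverData) (Rel : Set (Fin Q.nE × Fin Q.nE)) :
    PathAlg k Q →ₐ[k] GAlg k Q Rel := RingQuot.mkAlgHom k (GRel k Q Rel)

/-- Membership in the ideal `I` (the kernel of `kQ → kQ/I`). -/
def inI (k : Type) [Field k] (Q : QuiverData) (Rel : Set (Fin Q.nE × Fin Q.nE))
    (x : PathAlg k Q) : Prop := gmap k Q Rel x = 0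

/-- The idempotent `ε_v ∈ A` at a vertex `v`. -/
def vtxA (k : Type) [Field k] (Q : QuiverData) (Rel : Set (Fin Q.nE × Fin Q.nE))
    (v : Fin Q.nV) : GAlg k Q Rel := gmap k Q Rel (vtx k Q v)

/-- The image in `A` of an arrow `e`. -/
def arrA (k : Type) [Field k] (Q : QuiverData) (Rel : Set (Fin Q.nE × Fin Q.nE))
    (e : Fin Q.nE) : GAlg k Q Rel := gmap k Q Rel (arr k Q e)

/-- `(Q, I)` is a gentle pair (with `I` the ideal generated by the length-two
paths coming from `Rel`), and moreover `I` is admissible. -/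
structure IsGentle (k : Type) [Field k] (Q : QuiverData)
    (Rel : Set (Fin Q.nE × Fin Q.nE)) : Prop where
  /-- the generating relations are composable length-two paths -/
  comp_rel : ∀ p ∈ Rel, Q.tgt p.1 = Q.src p.2
  /-- every vertex is the source of at most two arrows -/
  src_card : ∀ v, (Finset.univ.filter fun e => Q.src e = v).card ≤ 2
  /-- every vertex is the target of at most two arrows -/
  tgt_card : ∀ v, (Finset.univ.filter fun e => Q.tgt e = v).card ≤ 2
  /-- for each arrow `a` there is at most one arrow `b` with `ab ∉ I` -/
  uniq_nonrel_right : ∀ a b c, ¬ inI k Q Rel (arr k Q a * arr k Q b) →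
    ¬ inI k Q Rel (arr k Q a * arr k Q c) → b = c
  /-- for each arrow `a` there is at most one arrow `c` with `ca ∉ I` -/
  uniq_nonrel_left : ∀ a b c, ¬ inI k Q Rel (arr k Q b * arr k Q a) →
    ¬ inI k Q Rel (arr k Q c * arr k Q a) → b = c
  /-- for each arrow `a` there is at most one (composable) arrow `b` with `ab ∈ I` -/
  uniq_rel_right : ∀ a b c, Q.tgt a = Q.src b → Q.tgt a = Q.src c →
    inI k Q Rel (arr k Q a * arr k Q b) → inI k Q Rel (arr k Q a * arr k Q c) → b = c
  /-- for each arrow `a` there is at most one (composable) arrow `c` with `ca ∈ I` -/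
  uniq_rel_left : ∀ a b c, Q.tgt b = Q.src a → Q.tgt c = Q.src a →
    inI k Q Rel (arr k Q b * arr k Q a) → inI k Q Rel (arr k Q c * arr k Q a) → b = c
  /-- admissibility: some power of the arrow ideal is contained in `I` -/
  admissible : ∃ m, 2 ≤ m ∧ ∀ f : Fin m → Fin Q.nE,
    inI k Q Rel (List.ofFn fun i => arr k Q (f i)).prod

/-- A full-relational oriented cycle `𝒞 = a_1 ⋯ a_len` (of length ≥ 3, as assumed
throughout the paper) in the bound quiver `(Q, I)`, encoded by a periodic
sequence of arrows.  `arrows i` is the arrow `a_{i+1}` (`0`-indexed),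
consecutive arrows are composable, all consecutive length-two paths lie in `I`,
and the vertices of the cycle are pairwise distinct. -/
structure FRCycle (k : Type) [Field k] (Q : QuiverData)
    (Rel : Set (Fin Q.nE × Fin Q.nE)) where
  len : ℕ
  len3 : 3 ≤ len
  arrows : ℕ → Fin Q.nE
  periodic : ∀ i, arrows (i + len) = arrows i
  comp : ∀ i, Q.tgt (arrows i) = Q.src (arrows (i + 1))
  frel : ∀ i, inI k Q Rel (arr k Q (arrows i) * arr k Q (arrows (i + 1)))
  vinj : ∀ i j, i < len → j < len → Q.src (arrows i) = Q.src (arrows j) → i = j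

/-- There are no full-relational oriented cycles of length `< 3` (the blanket
assumption of the paper). -/
def NoShortFRC (k : Type) [Field k] (Q : QuiverData)
    (Rel : Set (Fin Q.nE × Fin Q.nE)) : Prop :=
  ∀ (l : ℕ) (c : ℕ → Fin Q.nE), 1 ≤ l → (∀ i, c (i + l) = c i) →
    (∀ i, Q.tgt (c i) = Q.src (c (i + 1))) →
    (∀ i, inI k Q Rel (arr k Q (c i) * arr k Q (c (i + 1)))) → 3 ≤ l

/-- The set of arrows lying on the cycle. -/
def FRCycle.arrowSet {k : Type} [Field k] {Q : QuiverData}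
    {Rel : Set (Fin Q.nE × Fin Q.nE)} (C : FRCycle k Q Rel) : Set (Fin Q.nE) :=
  {a | ∃ i < C.len, C.arrows i = a}

/-- The idempotent `ε_{𝒞,t} ∈ A`: the sum of the `ε_v` over the vertices `v`
of the cycle `𝒞` other than `s(a_t)` and `t(a_t)`. -/
def epsCt (k : Type) [Field k] (Q : QuiverData) (Rel : Set (Fin Q.nE × Fin Q.nE))
    (C : FRCycle k Q Rel) (t : ℕ) : GAlg k Q Rel :=
  ∑ i ∈ (Finset.range C.len).filter
      (fun i => Q.src (C.arrows i) ≠ Q.src (C.arrows t) ∧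
        Q.src (C.arrows i) ≠ Q.tgt (C.arrows t)),
    vtxA k Q Rel (Q.src (C.arrows i))

/-- The relation identifying an element `ε` of a ring with `0`; the quotient is
`R/RεR`. -/
def QuotRel (R : Type) [Ring R] (ε : R) : R → R → Prop := fun x y => x = ε ∧ y = 0

/-- The quotient ring `R/RεR`. -/
def QuotBy (R : Type) [Ring R] (ε : R) := RingQuot (QuotRel R ε)

instance (R : Type) [Ring R] (ε : R) : Ring (QuotBy R ε) :=
  inferInstanceAs (Ring (RingQuot (QuotRel R ε)))

/-- The canonical projection `R → R/RεR`. -/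
def qmap (R : Type) [Ring R] (ε : R) : R →+* QuotBy R ε := RingQuot.mkRingHom (QuotRel R ε)

/-- The right ideal `xR`, as a right `R`-module (i.e. an `Rᵐᵒᵖ`-submodule of `R`). -/
def rIdeal (R : Type) [Ring R] (x : R) : Submodule Rᵐᵒᵖ R := Submodule.span Rᵐᵒᵖ {x}

/-- Restriction of scalars along `π : R →+* S` turns a right `S`-module into a
right `R`-module. -/
def modRestrict {R S : Type} [Ring R] [Ring S] (π : R →+* S) (M : Type)
    [AddCommGroup M] [Module Sᵐᵒᵖ M] : Module Rᵐᵒᵖ M :=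
  Module.compHom M (RingHom.op π)

/-- `M` is a Gorenstein projective right `R`-module:  there is a complete
resolution, i.e. an exact sequence `⋯ → P⁻² → P⁻¹ → P⁰ → P¹ → ⋯` of finitely
generated projective right `R`-modules which stays exact after applying
`Hom_R(-, R)`, with `M ≅ Im(P⁻¹ → P⁰)`. -/
def IsGProjMod (R : Type) [Ring R] (M : Type) [AddCommGroup M] [Module Rᵐᵒᵖ M] : Prop :=
  ∃ (P : ℤ → ModuleCat.{0} Rᵐᵒᵖ) (d : (n : ℤ) → (P n →ₗ[Rᵐᵒᵖ] P (n + 1))),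
    (∀ n, Module.Finite Rᵐᵒᵖ (P n)) ∧
    (∀ n, Module.Projective Rᵐᵒᵖ (P n)) ∧
    (∀ n, LinearMap.range (d n) = LinearMap.ker (d (n + 1))) ∧
    (∀ (n : ℤ) (g : P (n + 1) →ₗ[Rᵐᵒᵖ] R),
      g.comp (d n) = 0 ↔ ∃ h : P (n + 1 + 1) →ₗ[Rᵐᵒᵖ] R, h.comp (d (n + 1)) = g) ∧
    Nonempty (M ≃ₗ[Rᵐᵒᵖ] LinearMap.range (d (-1)))

/-- `M` is an indecomposable `S`-module. -/
def IsIndec (S : Type) [Ring S] (M : Type) [AddCommGroup M] [Module S M] : Prop :=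
  Nontrivial M ∧ ∀ N₁ N₂ : Submodule S M, IsCompl N₁ N₂ → N₁ = ⊥ ∨ N₂ = ⊥

/-- `M` is a non-projective indecomposable Gorenstein projective right `R`-module. -/
def IsNPIGProj (R : Type) [Ring R] (M : Type) [AddCommGroup M] [Module Rᵐᵒᵖ M] : Prop :=
  IsGProjMod R M ∧ IsIndec Rᵐᵒᵖ M ∧ ¬ Module.Projective Rᵐᵒᵖ M

/-- A right `S`-module `M`, viewed as a right `R`-module along `π : R →+* S`, is a
non-projective indecomposable Gorenstein projective right `R`-module. -/
def RestrIsNPIGProj {R S : Type} [Ring R] [Ring S] (π : R →+* S) (M : Type)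
    [AddCommGroup M] [Module Sᵐᵒᵖ M] : Prop :=
  letI := modRestrict π M
  IsNPIGProj R M

/-- The submodule `M·(RεR)` of a right `R`-module `M`;  the quotient
`M ⧸ M·(RεR)` realizes the tensor product `M ⊗_R R/RεR`. -/
def smulIdeal (R : Type) [Ring R] (ε : R) (M : Type) [AddCommGroup M]
    [Module Rᵐᵒᵖ M] : Submodule Rᵐᵒᵖ M :=
  Submodule.span Rᵐᵒᵖ {m | ∃ (x : M) (a b : R), m = (op (a * ε * b)) • x}

/-- `S` has finitely many finitely generated indecomposable modules up to
isomorphism.  (Applied with `S = Aᵐᵒᵖ` this says `A` is representation-finite.) -/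
def RepFinite (S : Type) [Ring S] : Prop :=
  ∃ (n : ℕ) (M : Fin n → ModuleCat.{0} S), ∀ N : ModuleCat.{0} S,
    Module.Finite S N → IsIndec S N → ∃ i, Nonempty (N ≃ₗ[S] M i)

/-- A cycle in the underlying undirected graph of `Q`:  a closed walk of
length ≥ 1 along edges (each traversed forwards or backwards) with pairwise
distinct vertices and pairwise distinct edges. -/
structure UCycle (Q : QuiverData) where
  len : ℕ
  len1 : 1 ≤ len
  edges : ℕ → Fin Q.nE
  dir : ℕ → Bool
  vert : ℕ → Fin Q.nV
  pe : ∀ i, edges (i + len) = edges i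
  pd : ∀ i, dir (i + len) = dir i
  pv : ∀ i, vert (i + len) = vert i
  incid_t : ∀ i, dir i = true →
    Q.src (edges i) = vert i ∧ Q.tgt (edges i) = vert (i + 1)
  incid_f : ∀ i, dir i = false →
    Q.tgt (edges i) = vert i ∧ Q.src (edges i) = vert (i + 1)
  vdist : ∀ i j, i < len → j < len → vert i = vert j → i = j
  edist : ∀ i j, i < len → j < len → edges i = edges j → i = j

/-- The set of edges of an undirected cycle. -/
def UCycle.edgeSet {Q : QuiverData} (C : UCycle Q) : Set (Fin Q.nE) :=
  {e | ∃ i < C.len, C.edges i = e}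

/-- The underlying graph of `Q` has exactly one cycle. -/
def OneCycle (Q : QuiverData) : Prop :=
  Nonempty (UCycle Q) ∧ ∀ C C' : UCycle Q, C.edgeSet = C'.edgeSet

/-- The projective dimension of (the module underlying) `M` is at most `n`. -/
def projDimLE (S : Type) [Ring S] : ℕ → ModuleCat.{0} S → Prop
  | 0, M => Module.Projective S M
  | n + 1, M => ∃ (P : ModuleCat.{0} S) (f : P →ₗ[S] M), Module.Projective S P ∧
      Function.Surjective f ∧ projDimLE S n (ModuleCat.of S (LinearMap.ker f))

/-- The injective dimension of (the module underlying) `M` is at most `n`. -/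
def injDimLE (S : Type) [Ring S] : ℕ → ModuleCat.{0} S → Prop
  | 0, M => Module.Injective S M
  | n + 1, M => ∃ (J : ModuleCat.{0} S) (f : M →ₗ[S] J), Module.Injective S J ∧
      Function.Injective f ∧ injDimLE S n (ModuleCat.of S (J ⧸ LinearMap.range f))

end

/-! ### The word basis of a quadratic monomial algebra -/

section WordBasis

variable {k : Type} [Field k] {Q : QuiverData} {Rel : Set (Fin Q.nE × Fin Q.nE)}

theorem vtxA_mul_vtxA (v w : Fin Q.nV) :
    vtxA k Q Rel v * vtxA k Q Rel w = if v = w then vtxA k Q Rel v else 0 := by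
  have h : vtx k Q v * vtx k Q w = if v = w then vtx k Q v else 0 := by
    have := RingQuot.mkAlgHom_rel k (PathRel.vtx_mul (k := k) (Q := Q) v w)
    rw [map_mul] at this
    refine this.trans ?_
    split_ifs
    · rfl
    · exact map_zero _
  rw [vtxA, vtxA, ← map_mul, h]
  split_ifs
  · rfl
  · exact map_zero _

theorem vtxA_mul_self (v : Fin Q.nV) :
    vtxA k Q Rel v * vtxA k Q Rel v = vtxA k Q Rel v := by
  simp [vtxA_mul_vtxA]

theorem vtxA_mul_vtxA_of_ne {v w : Fin Q.nV} (h : v ≠ w) :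
    vtxA k Q Rel v * vtxA k Q Rel w = 0 := by
  simp [vtxA_mul_vtxA, h]

theorem sum_vtxA : ∑ v, vtxA k Q Rel v = 1 := by
  have h : ∑ v, vtx k Q v = 1 := by
    have := RingQuot.mkAlgHom_rel k (PathRel.vtx_sum (k := k) (Q := Q))
    rw [map_sum, map_one] at this
    exact this
  simp only [vtxA, ← map_sum, h, map_one]

theorem vtxA_src_mul_arrA (e : Fin Q.nE) :
    vtxA k Q Rel (Q.src e) * arrA k Q Rel e = arrA k Q Rel e := by
  have h : vtx k Q (Q.src e) * arr k Q e = arr k Q e := by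
    have := RingQuot.mkAlgHom_rel k (PathRel.src_arr (k := k) (Q := Q) e)
    rw [map_mul] at this
    exact this
  rw [vtxA, arrA, ← map_mul, h]

theorem arrA_mul_vtxA_tgt (e : Fin Q.nE) :
    arrA k Q Rel e * vtxA k Q Rel (Q.tgt e) = arrA k Q Rel e := by
  have h : arr k Q e * vtx k Q (Q.tgt e) = arr k Q e := by
    have := RingQuot.mkAlgHom_rel k (PathRel.arr_tgt (k := k) (Q := Q) e)
    rw [map_mul] at this
    exact this
  rw [vtxA, arrA, ← map_mul, h]

theorem vtxA_mul_arrA_of_ne {v : Fin Q.nV} {e : Fin Q.nE} (h : v ≠ Q.src e) :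
    vtxA k Q Rel v * arrA k Q Rel e = 0 := by
  rw [← vtxA_src_mul_arrA, ← mul_assoc, vtxA_mul_vtxA_of_ne h, zero_mul]

theorem arrA_mul_vtxA_of_ne {v : Fin Q.nV} {e : Fin Q.nE} (h : Q.tgt e ≠ v) :
    arrA k Q Rel e * vtxA k Q Rel v = 0 := by
  rw [← arrA_mul_vtxA_tgt, mul_assoc, vtxA_mul_vtxA_of_ne h, mul_zero]

theorem arrA_mul_arrA_of_ne {e f : Fin Q.nE} (h : Q.tgt e ≠ Q.src f) :
    arrA k Q Rel e * arrA k Q Rel f = 0 := by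
  rw [← vtxA_src_mul_arrA f, ← mul_assoc, arrA_mul_vtxA_of_ne h, zero_mul]

theorem inI_iff {e f : Fin Q.nE} :
    inI k Q Rel (arr k Q e * arr k Q f) ↔ arrA k Q Rel e * arrA k Q Rel f = 0 := by
  rw [inI, map_mul]; rfl

theorem arrA_mul_arrA_of_rel {e f : Fin Q.nE} (h : (e, f) ∈ Rel) :
    arrA k Q Rel e * arrA k Q Rel f = 0 := by
  have := RingQuot.mkAlgHom_rel k (s := GRel k Q Rel)
    (x := arr k Q e * arr k Q f) (y := 0) ⟨⟨(e, f), h, rfl⟩, rfl⟩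
  rw [map_mul, map_zero] at this
  exact this

theorem GAlg.induction {p : GAlg k Q Rel → Prop}
    (scalar : ∀ c, p (algebraMap k _ c)) (vtx : ∀ v, p (vtxA k Q Rel v))
    (arr : ∀ e, p (arrA k Q Rel e)) (mul : ∀ x y, p x → p y → p (x * y))
    (add : ∀ x y, p x → p y → p (x + y)) (x : GAlg k Q Rel) : p x := by
  obtain ⟨y, rfl⟩ := RingQuot.mkAlgHom_surjective k (GRel k Q Rel) x
  obtain ⟨z, rfl⟩ := RingQuot.mkAlgHom_surjective k (PathRel k Q) y
  induction z using FreeAlgebra.induction with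
  | grade0 c =>
    have h := (congrArg (gmap k Q Rel) ((RingQuot.mkAlgHom k (PathRel k Q)).commutes c)).trans
      ((gmap k Q Rel).commutes c)
    exact h ▸ scalar c
  | grade1 x =>
    rcases x with v | e
    · exact vtx v
    · exact arr e
  | mul a b ha hb => rw [map_mul]; exact (map_mul (gmap k Q Rel) _ _).symm ▸ mul _ _ ha hb
  | add a b ha hb => rw [map_add]; exact (map_add (gmap k Q Rel) _ _).symm ▸ add _ _ ha hb

/-- A word: a starting vertex, followed by arrows in reverse order (the head of the
list is the last arrow). -/
abbrev Word (Q : QuiverData) := Fin Q.nV × List (Fin Q.nE)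

/-- The terminal vertex of a word. -/
def Word.last (p : Word Q) : Fin Q.nV := p.2.head?.elim p.1 Q.tgt

variable (Rel) in
/-- The arrow `b` can be appended to the word `p`. -/
def Word.CanSnoc (p : Word Q) (b : Fin Q.nE) : Prop :=
  p.last = Q.src b ∧ ∀ c ∈ p.2.head?, (c, b) ∉ Rel

variable (Rel) in
/-- The arrow `a` can be prepended to the word `p`. -/
def Word.CanCons (a : Fin Q.nE) (p : Word Q) : Prop :=
  Q.tgt a = p.1 ∧ ∀ c ∈ p.2.getLast?, (a, c) ∉ Rel

open Classical in
/-- The projection onto the words ending at `w`. -/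
noncomputable def projLast (k : Type) [Field k] (w : Fin Q.nV) : Module.End k (Word Q →₀ k) :=
  Finsupp.linearCombination k fun p => if p.last = w then Finsupp.single p 1 else 0

open Classical in
/-- Appending an arrow to words. -/
noncomputable def snocArr (k : Type) [Field k] (Rel : Set (Fin Q.nE × Fin Q.nE))
    (b : Fin Q.nE) : Module.End k (Word Q →₀ k) :=
  Finsupp.linearCombination k fun p =>
    if p.CanSnoc Rel b then Finsupp.single (p.1, b :: p.2) 1 else 0

open Classical in
/-- Prepending an arrow to words. -/
noncomputable def consArr (k : Type) [Field k] (Rel : Set (Fin Q.nE × Fin Q.nE))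
    (a : Fin Q.nE) : Module.End k (Word Q →₀ k) :=
  Finsupp.linearCombination k fun p =>
    if Word.CanCons Rel a p then Finsupp.single (Q.src a, p.2 ++ [a]) 1 else 0

open Classical in
theorem projLast_single (w : Fin Q.nV) (p : Word Q) :
    projLast k w (Finsupp.single p 1) = if p.last = w then Finsupp.single p 1 else 0 := by
  simp [projLast]

open Classical in
theorem snocArr_single (b : Fin Q.nE) (p : Word Q) :
    snocArr k Rel b (Finsupp.single p 1) =
      if p.CanSnoc Rel b then Finsupp.single (p.1, b :: p.2) 1 else 0 := by
  simp [snocArr]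

open Classical in
theorem consArr_single (a : Fin Q.nE) (p : Word Q) :
    consArr k Rel a (Finsupp.single p 1) =
      if Word.CanCons Rel a p then Finsupp.single (Q.src a, p.2 ++ [a]) 1 else 0 := by
  simp [consArr]

theorem wordEnd_ext {M : Type*} [AddCommMonoid M] [Module k M] {f g : (Word Q →₀ k) →ₗ[k] M}
    (h : ∀ p, f (Finsupp.single p 1) = g (Finsupp.single p 1)) : f = g :=
  Finsupp.lhom_ext' fun p => LinearMap.ext_ring (h p)

theorem projLast_mul (v w : Fin Q.nV) :
    projLast k w * projLast k v = if v = w then projLast k v else 0 := by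
  refine wordEnd_ext fun p => ?_
  by_cases h : p.last = v <;> by_cases h' : v = w <;> simp_all [projLast_single]

theorem sum_projLast : ∑ v : Fin Q.nV, projLast k v = 1 := by
  refine wordEnd_ext fun p => ?_
  simp [projLast_single]

theorem snocArr_mul_projLast (e : Fin Q.nE) :
    snocArr k Rel e * projLast k (Q.src e) = snocArr k Rel e := by
  refine wordEnd_ext fun p => ?_
  by_cases h : p.last = Q.src e <;> simp [projLast_single, snocArr_single, Word.CanSnoc, h]

theorem projLast_mul_snocArr (e : Fin Q.nE) :
    projLast k (Q.tgt e) * snocArr k Rel e = snocArr k Rel e := by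
  refine wordEnd_ext fun p => ?_
  by_cases h : p.CanSnoc Rel e <;> simp [projLast_single, snocArr_single, Word.last, h]

theorem snocArr_mul_snocArr {e f : Fin Q.nE} (h : (e, f) ∈ Rel) :
    snocArr k Rel f * snocArr k Rel e = 0 := by
  refine wordEnd_ext fun p => ?_
  by_cases h' : p.CanSnoc Rel e
  · have : ¬ Word.CanSnoc Rel (p.1, e :: p.2) f := fun H => H.2 e (by simp) h
    simp [snocArr_single, h', this]
  · simp [snocArr_single, h']

theorem consArr_mul_projLast (a : Fin Q.nE) (w : Fin Q.nV) :
    consArr k Rel a * projLast k w = projLast k w * consArr k Rel a := by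
  refine wordEnd_ext fun p => ?_
  by_cases h : Word.CanCons Rel a p
  · have : Word.last (Q.src a, p.2 ++ [a]) = p.last := by
      rcases p with ⟨v, _ | ⟨c, L⟩⟩
      · exact h.1
      · rfl
    by_cases h' : p.last = w <;> simp [projLast_single, consArr_single, h, h', this]
  · by_cases h' : p.last = w <;> simp [projLast_single, consArr_single, h, h']

theorem consArr_mul_snocArr (a b : Fin Q.nE) :
    consArr k Rel a * snocArr k Rel b = snocArr k Rel b * consArr k Rel a := by
  refine wordEnd_ext fun p => ?_
  have key : (p.CanSnoc Rel b ∧ Word.CanCons Rel a (p.1, b :: p.2)) ↔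
      (Word.CanCons Rel a p ∧ Word.CanSnoc Rel (Q.src a, p.2 ++ [a]) b) := by
    rcases p with ⟨v, _ | ⟨c, L⟩⟩
    · simp only [Word.CanSnoc, Word.CanCons, Word.last]
      simp
      constructor
      · rintro ⟨h₁, h₂, h₃⟩
        exact ⟨h₂, h₂.trans h₁, h₃⟩
      · rintro ⟨h₁, h₂, h₃⟩
        exact ⟨h₁.symm.trans h₂, h₁, h₃⟩
    · simp only [Word.CanSnoc, Word.CanCons, Word.last, List.getLast?_cons_cons]
      simp
      tauto
  by_cases h₁ : p.CanSnoc Rel b <;> by_cases h₂ : Word.CanCons Rel a p <;>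
    by_cases h₃ : Word.CanCons Rel a (p.1, b :: p.2) <;> simp_all [snocArr_single, consArr_single]

theorem snocArr_apply {b : Fin Q.nE} {p : Word Q} (h : p.CanSnoc Rel b) (f : Word Q →₀ k) :
    snocArr k Rel b f (p.1, b :: p.2) = f p := by
  have : (Finsupp.lapply (p.1, b :: p.2)) ∘ₗ snocArr k Rel b =
      (Finsupp.lapply p : (Word Q →₀ k) →ₗ[k] k) := by
    refine wordEnd_ext fun q => ?_
    by_cases hq : q = p
    · subst hq; simp [snocArr_single, h]
    · have hq' : (q.1, b :: q.2) ≠ (p.1, b :: p.2) := by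
        intro H; apply hq; simp only [Prod.mk.injEq, List.cons.injEq] at H
        exact Prod.ext H.1 H.2.2
      by_cases h' : q.CanSnoc Rel b
      · simp [snocArr_single, h', Finsupp.single_apply, hq]
        intro h1 h2; exact hq (Prod.ext h1 h2)
      · simp [snocArr_single, h', hq]
  exact LinearMap.congr_fun this f

theorem consArr_apply {a : Fin Q.nE} {p : Word Q} (h : Word.CanCons Rel a p)
    (f : Word Q →₀ k) : consArr k Rel a f (Q.src a, p.2 ++ [a]) = f p := by
  have : (Finsupp.lapply (Q.src a, p.2 ++ [a])) ∘ₗ consArr k Rel a =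
      (Finsupp.lapply p : (Word Q →₀ k) →ₗ[k] k) := by
    refine wordEnd_ext fun q => ?_
    by_cases hq : q = p
    · subst hq; simp [consArr_single, h]
    · by_cases h' : Word.CanCons Rel a q
      · simp [consArr_single, h', Finsupp.single_apply, hq]
        intro h2; exact hq (Prod.ext (h'.1.symm.trans h.1) h2)
      · simp [consArr_single, h', hq]
  exact LinearMap.congr_fun this f

variable (k Q) in
/-- The right action of the path algebra on words. -/
noncomputable def pathAct (Rel : Set (Fin Q.nE × Fin Q.nE)) :
    PathAlg k Q →ₐ[k] (Module.End k (Word Q →₀ k))ᵐᵒᵖ :=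
  RingQuot.liftAlgHom k ⟨FreeAlgebra.lift k
    (Sum.elim (fun v => op (projLast k v)) fun e => op (snocArr k Rel e)), by
    intro x y h
    induction h with
    | vtx_mul v w =>
      simp only [map_mul, FreeAlgebra.lift_ι_apply, Sum.elim_inl, ← op_mul, projLast_mul]
      split_ifs <;> simp
    | vtx_sum =>
      simp only [map_sum, FreeAlgebra.lift_ι_apply, Sum.elim_inl, map_one]
      rw [← Finset.op_sum, sum_projLast, op_one]
    | src_arr e =>
      simp only [map_mul, FreeAlgebra.lift_ι_apply, Sum.elim_inl, Sum.elim_inr, ← op_mul,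
        snocArr_mul_projLast]
    | arr_tgt e =>
      simp only [map_mul, FreeAlgebra.lift_ι_apply, Sum.elim_inl, Sum.elim_inr, ← op_mul,
        projLast_mul_snocArr]⟩

theorem pathAct_vtx (v : Fin Q.nV) : pathAct k Q Rel (vtx k Q v) = op (projLast k v) := by
  refine (RingQuot.liftAlgHom_mkAlgHom_apply _ _ _ _).trans ?_
  simp

theorem pathAct_arr (e : Fin Q.nE) : pathAct k Q Rel (arr k Q e) = op (snocArr k Rel e) := by
  refine (RingQuot.liftAlgHom_mkAlgHom_apply _ _ _ _).trans ?_
  simp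

variable (k Q Rel) in
/-- The right action of `kQ/I` on words. -/
noncomputable def wordAct : GAlg k Q Rel →ₐ[k] (Module.End k (Word Q →₀ k))ᵐᵒᵖ :=
  RingQuot.liftAlgHom k ⟨pathAct k Q Rel, by
    rintro x y ⟨⟨p, hp, rfl⟩, rfl⟩
    rw [map_mul, map_zero, pathAct_arr, pathAct_arr, ← op_mul, snocArr_mul_snocArr hp, op_zero]⟩

theorem wordAct_vtxA (v : Fin Q.nV) :
    wordAct k Q Rel (vtxA k Q Rel v) = op (projLast k v) :=
  (RingQuot.liftAlgHom_mkAlgHom_apply _ _ _ _).trans (pathAct_vtx v)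

theorem wordAct_arrA (e : Fin Q.nE) :
    wordAct k Q Rel (arrA k Q Rel e) = op (snocArr k Rel e) :=
  (RingQuot.liftAlgHom_mkAlgHom_apply _ _ _ _).trans (pathAct_arr e)

/-- The expansion of an element of `kQ/I` as a combination of words. -/
noncomputable def toWords (x : GAlg k Q Rel) : Word Q →₀ k :=
  (wordAct k Q Rel x).unop (∑ v, Finsupp.single (v, []) 1)

theorem toWords_add (x y : GAlg k Q Rel) : toWords (x + y) = toWords x + toWords y := by
  rw [toWords, map_add, unop_add, LinearMap.add_apply]; rfl

theorem toWords_zero : toWords (0 : GAlg k Q Rel) = 0 := by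
  simp [toWords]

theorem toWords_mul_arrA (x : GAlg k Q Rel) (b : Fin Q.nE) :
    toWords (x * arrA k Q Rel b) = snocArr k Rel b (toWords x) := by
  simp [toWords, wordAct_arrA]

theorem consArr_wordAct (a : Fin Q.nE) (x : GAlg k Q Rel) :
    consArr k Rel a * (wordAct k Q Rel x).unop = (wordAct k Q Rel x).unop * consArr k Rel a := by
  induction x using GAlg.induction with
  | scalar c =>
    rw [AlgHom.commutes]
    exact (Algebra.commutes c (consArr k Rel a)).symm
  | vtx v => simpa [wordAct_vtxA] using consArr_mul_projLast a v
  | arr e => simpa [wordAct_arrA] using consArr_mul_snocArr a e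
  | mul x y hx hy =>
    rw [map_mul, unop_mul, ← mul_assoc, hy, mul_assoc, hx, mul_assoc]
  | add x y hx hy => rw [map_add, unop_add, mul_add, add_mul, hx, hy]

theorem toWords_arrA (a : Fin Q.nE) :
    toWords (arrA k Q Rel a) = Finsupp.single (Q.src a, [a]) 1 := by
  have : ∀ v : Fin Q.nV, Word.CanSnoc Rel (v, []) a ↔ v = Q.src a := by
    intro v; simp [Word.CanSnoc, Word.last]
  simp [toWords, wordAct_arrA, snocArr_single, this]

theorem toWords_arrA_mul (a : Fin Q.nE) (x : GAlg k Q Rel) :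
    toWords (arrA k Q Rel a * x) = consArr k Rel a (toWords x) := by
  have h : consArr k Rel a (∑ v, Finsupp.single (v, []) 1) = toWords (arrA k Q Rel a) := by
    have : ∀ v : Fin Q.nV, Word.CanCons Rel a (v, []) ↔ Q.tgt a = v := by
      intro v; simp [Word.CanCons]
    simp [toWords_arrA, consArr_single, this]
  have := LinearMap.congr_fun (consArr_wordAct a x) (∑ v, Finsupp.single (v, []) 1)
  rw [Module.End.mul_apply, Module.End.mul_apply, h] at this
  simp only [toWords] at this ⊢
  rw [map_mul, unop_mul, Module.End.mul_apply, this]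

/-- The element of `kQ/I` represented by a word. -/
noncomputable def Word.eval (k : Type) [Field k] {Q : QuiverData} (Rel : Set (Fin Q.nE × Fin Q.nE))
    (p : Word Q) : GAlg k Q Rel :=
  vtxA k Q Rel p.1 * (p.2.reverse.map (arrA k Q Rel)).prod

theorem Word.eval_cons (v : Fin Q.nV) (c : Fin Q.nE) (L : List (Fin Q.nE)) :
    Word.eval k Rel (v, c :: L) = Word.eval k Rel (v, L) * arrA k Q Rel c := by
  simp [Word.eval, mul_assoc]

theorem Word.eval_append (v : Fin Q.nV) (c : Fin Q.nE) (L : List (Fin Q.nE)) :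
    Word.eval k Rel (v, L ++ [c]) =
      vtxA k Q Rel v * arrA k Q Rel c * (L.reverse.map (arrA k Q Rel)).prod := by
  simp [Word.eval, mul_assoc]

theorem Word.eval_mul_vtxA (p : Word Q) (w : Fin Q.nV) :
    p.eval k Rel * vtxA k Q Rel w = if p.last = w then p.eval k Rel else 0 := by
  rcases p with ⟨v, _ | ⟨c, L⟩⟩
  · simp [Word.eval, Word.last, vtxA_mul_vtxA]
  · simp only [Word.eval_cons, Word.last, List.head?_cons, Option.elim_some, mul_assoc]
    split_ifs with h
    · rw [← h, arrA_mul_vtxA_tgt]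
    · rw [arrA_mul_vtxA_of_ne h, mul_zero]

open Classical in
theorem Word.eval_mul_arrA (p : Word Q) (b : Fin Q.nE) :
    p.eval k Rel * arrA k Q Rel b =
      if p.CanSnoc Rel b then Word.eval k Rel (p.1, b :: p.2) else 0 := by
  split_ifs with h
  · rw [Word.eval_cons]
  · rw [Word.CanSnoc, not_and_or] at h
    rcases h with h | h
    · rw [← vtxA_src_mul_arrA, ← mul_assoc, Word.eval_mul_vtxA, if_neg h, zero_mul]
    · push Not at h
      obtain ⟨c, hc, hr⟩ := h
      rcases p with ⟨v, _ | ⟨d, L⟩⟩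
      · simp at hc
      · obtain rfl : d = c := by simpa using hc
        rw [Word.eval_cons, mul_assoc, arrA_mul_arrA_of_rel hr, mul_zero]

/-- Evaluation of combinations of words. -/
noncomputable def ofWords (k : Type) [Field k] {Q : QuiverData} (Rel : Set (Fin Q.nE × Fin Q.nE)) :
    (Word Q →₀ k) →ₗ[k] GAlg k Q Rel :=
  Finsupp.linearCombination k (Word.eval k Rel)

theorem ofWords_wordAct (x : GAlg k Q Rel) (f : Word Q →₀ k) :
    ofWords k Rel ((wordAct k Q Rel x).unop f) = ofWords k Rel f * x := by
  suffices h : ofWords k Rel ∘ₗ (wordAct k Q Rel x).unop =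
      (LinearMap.mulRight k x) ∘ₗ ofWords k Rel from LinearMap.congr_fun h f
  induction x using GAlg.induction with
  | scalar c =>
    refine LinearMap.ext fun f => ?_
    simp [Algebra.smul_def, Algebra.commutes]
  | vtx v =>
    refine wordEnd_ext fun p => ?_
    by_cases h : p.last = v <;>
      simp [wordAct_vtxA, projLast_single, ofWords, Word.eval_mul_vtxA, h]
  | arr e =>
    refine wordEnd_ext fun p => ?_
    by_cases h : p.CanSnoc Rel e <;>
      simp [wordAct_arrA, snocArr_single, ofWords, Word.eval_mul_arrA, h]
  | mul x y hx hy =>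
    refine LinearMap.ext fun f => ?_
    have h₁ := LinearMap.congr_fun hy ((wordAct k Q Rel x).unop f)
    have h₂ := LinearMap.congr_fun hx f
    simp only [LinearMap.comp_apply, LinearMap.mulRight_apply] at h₁ h₂
    simp [h₁, h₂, mul_assoc]
  | add x y hx hy =>
    rw [map_add, unop_add, LinearMap.comp_add, hx, hy]
    refine LinearMap.ext fun f => ?_
    simp [mul_add]

theorem ofWords_toWords (x : GAlg k Q Rel) : ofWords k Rel (toWords x) = x := by
  rw [toWords, ofWords_wordAct]
  have : ofWords k Rel (∑ v : Fin Q.nV, Finsupp.single (v, []) 1) = 1 := by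
    simp [ofWords, Word.eval, sum_vtxA]
  rw [this, one_mul]

theorem eq_sum_words (x : GAlg k Q Rel) :
    x = ∑ p ∈ (toWords x).support, toWords x p • p.eval k Rel := by
  conv_lhs => rw [← ofWords_toWords x, ofWords, Finsupp.linearCombination_apply]
  rfl

end WordBasis

/-! ### Modules over an abstract ring -/

section Abstract

variable {R : Type} [Ring R]

theorem mem_rIdeal {x y : R} : y ∈ rIdeal R x ↔ ∃ z, y = x * z := by
  rw [rIdeal, Submodule.mem_span_singleton]
  constructor
  · rintro ⟨r, rfl⟩
    exact ⟨r.unop, rfl⟩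
  · rintro ⟨z, rfl⟩
    exact ⟨op z, rfl⟩

theorem self_mem_rIdeal (x : R) : x ∈ rIdeal R x := mem_rIdeal.2 ⟨1, (mul_one x).symm⟩

theorem mem_rIdeal_of_idem {e x : R} (he : e * e = e) : x ∈ rIdeal R e ↔ e * x = x := by
  rw [mem_rIdeal]
  constructor
  · rintro ⟨z, rfl⟩
    rw [← mul_assoc, he]
  · exact fun h => ⟨x, h.symm⟩

/-- Left multiplication as a map of right modules. -/
def leftMul (a : R) : R →ₗ[Rᵐᵒᵖ] R where
  toFun x := a * x
  map_add' := mul_add a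
  map_smul' r x := by simp [mul_assoc]

theorem rIdeal_projective {e : R} (he : e * e = e) : Module.Projective Rᵐᵒᵖ (rIdeal R e) := by
  have : Module.Projective Rᵐᵒᵖ R :=
    Module.Projective.of_equiv (LinearEquiv.symm
      { toFun := fun x : R => op x, invFun := unop, map_add' := fun _ _ => rfl,
        map_smul' := fun r x => rfl, left_inv := fun _ => rfl, right_inv := fun _ => rfl } :
        Rᵐᵒᵖ ≃ₗ[Rᵐᵒᵖ] R)
  refine Module.Projective.of_split (rIdeal R e).subtype
    ((leftMul e).codRestrict (rIdeal R e) fun x => mem_rIdeal.2 ⟨x, rfl⟩) ?_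
  refine LinearMap.ext fun x => Subtype.ext ?_
  exact (mem_rIdeal_of_idem he).1 x.2

/-- Left multiplication by `a = e a`, as a map `fR → eR`. -/
def rIdealMul {e a : R} (f : R) (h : e * a = a) : rIdeal R f →ₗ[Rᵐᵒᵖ] rIdeal R e :=
  ((leftMul a).codRestrict (rIdeal R e) fun x =>
    mem_rIdeal.2 ⟨a * x, by rw [← mul_assoc, h]; rfl⟩).comp (rIdeal R f).subtype

theorem hom_rIdeal_apply {e : R} (he : e * e = e) (g : rIdeal R e →ₗ[Rᵐᵒᵖ] R) (x : rIdeal R e) :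
    g x = g ⟨e, self_mem_rIdeal e⟩ * x := by
  rw [← op_smul_eq_mul, ← map_smul]
  congr 1
  exact Subtype.ext ((mem_rIdeal_of_idem he).1 x.2).symm

theorem isGProjMod_rIdeal (e a : ℤ → R) (he : ∀ i, e i * e i = e i)
    (hl : ∀ i, e i * a i = a i) (hr : ∀ i, a i * e (i + 1) = a i)
    (haa : ∀ i, a i * a (i + 1) = 0)
    (hL : ∀ i x, e (i + 1) * x = x → a i * x = 0 → ∃ y, x = a (i + 1) * y)
    (hR : ∀ i x, x * e (i + 1) = x → x * a (i + 1) = 0 → ∃ y, x = y * a i) (i : ℤ) :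
    IsGProjMod R (rIdeal R (a i)) := by
  have hd : ∀ n : ℤ, i - n = i - (n + 1) + 1 := fun n => by ring
  refine ⟨fun n => ModuleCat.of Rᵐᵒᵖ (rIdeal R (e (i - n))),
    fun n => rIdealMul (e (i - n)) (hl (i - (n + 1))), fun n => ?_, fun n => ?_, fun n => ?_,
    fun n g => ?_, ⟨LinearEquiv.ofEq _ _ ?_ ≪≫ₗ
      (Submodule.equivMapOfInjective (rIdeal R (e (i - (-1 + 1)))).subtype
        (Submodule.subtype_injective _) (LinearMap.range
          (rIdealMul (e (i - -1)) (hl (i - (-1 + 1)))))).symm⟩⟩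
  · exact Module.Finite.span_singleton _ _
  · exact rIdeal_projective (he _)
  · have h2 := haa (i - (n + 1 + 1))
    rw [← hd (n + 1)] at h2
    refine le_antisymm ?_ fun x hx => ?_
    · rintro _ ⟨x, rfl⟩
      refine Subtype.ext ?_
      change a (i - (n + 1 + 1)) * (a (i - (n + 1)) * x) = 0
      rw [← mul_assoc, h2, zero_mul]
    · have hx0 : a (i - (n + 1 + 1)) * (x : R) = 0 := congrArg Subtype.val hx
      have h3 := hL (i - (n + 1 + 1)) x
      rw [← hd (n + 1)] at h3
      obtain ⟨y, hy⟩ := h3 ((mem_rIdeal_of_idem (he _)).1 x.2) hx0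
      refine ⟨⟨e (i - n) * y, mem_rIdeal.2 ⟨y, rfl⟩⟩, Subtype.ext ?_⟩
      change a (i - (n + 1)) * (e (i - n) * y) = x
      have h4 := hr (i - (n + 1))
      rw [← hd n] at h4
      rw [← mul_assoc, h4, hy]
  · have h2 := haa (i - (n + 1 + 1))
    rw [← hd (n + 1)] at h2
    have hr1 := hr (i - (n + 1))
    rw [← hd n] at hr1
    have hr2 := hr (i - (n + 1 + 1))
    rw [← hd (n + 1)] at hr2
    constructor
    · intro hg
      set x := g ⟨e (i - (n + 1)), self_mem_rIdeal _⟩ with hx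
      have hgx : ∀ z, g z = x * (z : R) := fun z => hom_rIdeal_apply (he _) g z
      have h3 := hR (i - (n + 1 + 1)) x
      rw [← hd (n + 1)] at h3
      have hx1 : x * e (i - (n + 1)) = x := (hgx ⟨e (i - (n + 1)), self_mem_rIdeal _⟩).symm
      have hx2 : x * a (i - (n + 1)) = 0 := by
        have := LinearMap.congr_fun hg ⟨e (i - n), self_mem_rIdeal _⟩
        rw [LinearMap.comp_apply, hgx] at this
        change x * (a (i - (n + 1)) * e (i - n)) = 0 at this
        rwa [hr1] at this
      obtain ⟨y, hy⟩ := h3 hx1 hx2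
      refine ⟨(leftMul y).comp (rIdeal R (e (i - (n + 1 + 1)))).subtype, LinearMap.ext fun z => ?_⟩
      rw [hgx, hy, mul_assoc]
      rfl
    · rintro ⟨h, rfl⟩
      refine LinearMap.ext fun z => ?_
      have : rIdealMul (e (i - (n + 1))) (hl (i - (n + 1 + 1)))
          (rIdealMul (e (i - n)) (hl (i - (n + 1))) z) = 0 := by
        refine Subtype.ext ?_
        change a (i - (n + 1 + 1)) * (a (i - (n + 1)) * z) = 0
        rw [← mul_assoc, h2, zero_mul]
      exact (congrArg h this).trans (map_zero h)
  · have hi : a (i - (-1 + 1)) = a i := by congr 1; ring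
    have hr1 := hr (i - (-1 + 1))
    rw [← hd (-1)] at hr1
    ext x
    rw [mem_rIdeal, Submodule.mem_map, ← hi]
    constructor
    · rintro ⟨z, rfl⟩
      refine ⟨_, ⟨⟨e (i - -1) * z, mem_rIdeal.2 ⟨z, rfl⟩⟩, rfl⟩, ?_⟩
      change a (i - (-1 + 1)) * (e (i - -1) * z) = _
      rw [← mul_assoc, hr1]
    · rintro ⟨_, ⟨z, rfl⟩, rfl⟩
      exact ⟨z, rfl⟩

theorem IsNPIGProj.of_equiv {M N : Type} [AddCommGroup M] [AddCommGroup N] [Module Rᵐᵒᵖ M]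
    [Module Rᵐᵒᵖ N] (f : M ≃ₗ[Rᵐᵒᵖ] N) (h : IsNPIGProj R N) : IsNPIGProj R M := by
  obtain ⟨⟨P, d, h₁, h₂, h₃, h₄, ⟨g⟩⟩, ⟨hN, hi⟩, hp⟩ := h
  refine ⟨⟨P, d, h₁, h₂, h₃, h₄, ⟨f.trans g⟩⟩, ⟨f.toEquiv.nontrivial, fun N₁ N₂ hc => ?_⟩,
    fun H => hp (Module.Projective.of_equiv f)⟩
  have := hi _ _ ((Submodule.orderIsoMapComap f).isCompl hc)
  simpa using this

theorem isIndec_of_mem {x : R} (hx : x ≠ 0)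
    (h : ∀ N₁ N₂ : Submodule Rᵐᵒᵖ R, ∀ n₁ ∈ N₁, ∀ n₂ ∈ N₂, N₁ ≤ rIdeal R x → N₂ ≤ rIdeal R x →
      n₁ + n₂ = x → x ∈ N₁ ∨ x ∈ N₂) : IsIndec Rᵐᵒᵖ (rIdeal R x) := by
  refine ⟨⟨⟨⟨x, self_mem_rIdeal x⟩, 0, fun H => hx (congrArg Subtype.val H)⟩⟩,
    fun N₁ N₂ hc => ?_⟩
  have hx' : (⟨x, self_mem_rIdeal x⟩ : rIdeal R x) ∈ N₁ ⊔ N₂ := hc.sup_eq_top ▸ trivial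
  obtain ⟨n₁, h₁, n₂, h₂, hn⟩ := Submodule.mem_sup.1 hx'
  have top : ∀ N : Submodule Rᵐᵒᵖ (rIdeal R x),
      x ∈ N.map (rIdeal R x).subtype → N = ⊤ := by
    rintro N ⟨z, hz, hzx⟩
    refine eq_top_iff.2 fun y _ => ?_
    obtain ⟨w, hw⟩ := mem_rIdeal.1 y.2
    have : y = op w • z := Subtype.ext (hw.trans (congrArg (· * w) hzx.symm))
    exact this ▸ N.smul_mem _ hz
  rcases h (N₁.map (rIdeal R x).subtype) (N₂.map (rIdeal R x).subtype) n₁ ⟨n₁, h₁, rfl⟩ n₂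
    ⟨n₂, h₂, rfl⟩ (Submodule.map_subtype_le _ _) (Submodule.map_subtype_le _ _)
    (congrArg Subtype.val hn) with H | H
  · right
    have := hc.inf_eq_bot
    rwa [top _ H, top_inf_eq] at this
  · left
    have := hc.inf_eq_bot
    rwa [top _ H, inf_top_eq] at this

theorem annihilates_of_qmap_eq_zero {a ε : R} (h : ∀ x, a * x * ε = 0) {z : R}
    (hz : qmap R ε z = 0) : a * z = 0 := by
  let ρ : R →+* (Module.End ℤ (rIdeal R a))ᵐᵒᵖ :=
    { toFun := fun r => op
        { toFun := fun x => op r • x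
          map_add' := fun x y => smul_add _ x y
          map_smul' := fun n x => smul_comm _ _ _ }
      map_one' := by
        refine unop_injective (LinearMap.ext fun x => ?_)
        exact one_smul _ x
      map_mul' := fun r s => by
        refine unop_injective (LinearMap.ext fun x => ?_)
        exact mul_smul (op s) (op r) x
      map_zero' := by
        refine unop_injective (LinearMap.ext fun x => ?_)
        exact zero_smul _ x
      map_add' := fun r s => by
        refine unop_injective (LinearMap.ext fun x => ?_)
        exact add_smul (op r) (op s) x }
  have hρ : ∀ ⦃x y⦄, QuotRel R ε x y → ρ x = ρ y := by
    rintro x y ⟨rfl, rfl⟩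
    refine unop_injective (LinearMap.ext fun y => Subtype.ext ?_)
    obtain ⟨w, hw⟩ := mem_rIdeal.1 y.2
    change (y : R) * x = y * 0
    rw [hw, h, mul_zero]
  have h0 : ρ z = 0 := by
    have := RingQuot.lift_mkRingHom_apply ρ hρ z
    rw [← this]
    exact (congrArg _ hz).trans (map_zero _)
  exact congrArg Subtype.val (LinearMap.congr_fun (congrArg unop h0) ⟨a, self_mem_rIdeal a⟩)

theorem qmap_eps (ε : R) : qmap R ε ε = 0 :=
  (RingQuot.mkRingHom_rel (r := QuotRel R ε) ⟨rfl, rfl⟩).trans (map_zero _)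

/-- If left multiplication by `a` and the projection to `R/RεR` have the same kernel on `eR`,
then `ē(R/RεR)` and `aR` are isomorphic right `R`-modules. -/
theorem nonempty_equiv_rIdeal {a e ε : R} (h : ∀ x, qmap R ε (e * x) = 0 ↔ a * x = 0) :
    letI := modRestrict (qmap R ε) (rIdeal (QuotBy R ε) (qmap R ε e))
    Nonempty (rIdeal (QuotBy R ε) (qmap R ε e) ≃ₗ[Rᵐᵒᵖ] rIdeal R a) := by
  let _ := modRestrict (qmap R ε) (rIdeal (QuotBy R ε) (qmap R ε e))
  let f : R →ₗ[Rᵐᵒᵖ] rIdeal R a :=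
    (leftMul a).codRestrict _ fun x => mem_rIdeal.2 ⟨x, rfl⟩
  let g : R →ₗ[Rᵐᵒᵖ] rIdeal (QuotBy R ε) (qmap R ε e) :=
    { toFun := fun x => ⟨qmap R ε (e * x), mem_rIdeal.2 ⟨qmap R ε x, map_mul _ _ _⟩⟩
      map_add' := fun x y => Subtype.ext (by
        change qmap R ε (e * (x + y)) = qmap R ε (e * x) + qmap R ε (e * y)
        rw [mul_add, map_add])
      map_smul' := fun r x => Subtype.ext (by
        change qmap R ε (e * (x * r.unop)) = qmap R ε (e * x) * qmap R ε r.unop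
        rw [← mul_assoc, map_mul]) }
  have hf : Function.Surjective f := by
    rintro ⟨y, hy⟩
    obtain ⟨z, rfl⟩ := mem_rIdeal.1 hy
    exact ⟨z, rfl⟩
  have hg : Function.Surjective g := by
    rintro ⟨y, hy⟩
    obtain ⟨z, rfl⟩ := mem_rIdeal.1 hy
    obtain ⟨z, rfl⟩ := RingQuot.mkRingHom_surjective _ z
    exact ⟨z, Subtype.ext (map_mul (qmap R ε) _ _)⟩
  have hk : LinearMap.ker g = LinearMap.ker f := by
    ext x
    rw [LinearMap.mem_ker, LinearMap.mem_ker, Subtype.ext_iff, Subtype.ext_iff]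
    exact h x
  exact ⟨(g.quotKerEquivOfSurjective hg).symm ≪≫ₗ Submodule.quotEquivOfEq _ _ hk ≪≫ₗ
    f.quotKerEquivOfSurjective hf⟩

end Abstract

/-! ### Directed walks and cycles -/

section Walks

/-- There is an arrow from `v` to `w`. -/
def QuiverData.Step (Q : QuiverData) (v w : Fin Q.nV) : Prop :=
  ∃ e, Q.src e = v ∧ Q.tgt e = w

/-- `w` is the vertex sequence, and `c` the arrow sequence, of a directed walk of length `n`
from `x` to `y`. -/
structure QuiverData.IsWalk (Q : QuiverData) (x y : Fin Q.nV) (n : ℕ) (w : ℕ → Fin Q.nV)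
    (c : ℕ → Fin Q.nE) : Prop where
  start : w 0 = x
  finish : w n = y
  src : ∀ i < n, Q.src (c i) = w i
  tgt : ∀ i < n, Q.tgt (c i) = w (i + 1)

theorem QuiverData.exists_isWalk {Q : QuiverData} (e₀ : Fin Q.nE) {x y : Fin Q.nV}
    (h : Relation.ReflTransGen Q.Step x y) : ∃ n w c, Q.IsWalk x y n w c := by
  induction h using Relation.ReflTransGen.head_induction_on with
  | refl =>
    exact ⟨0, fun _ => y, fun _ => e₀, ⟨rfl, rfl, fun i hi => absurd hi (Nat.not_lt_zero _),
      fun i hi => absurd hi (Nat.not_lt_zero _)⟩⟩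
  | head h _ ih =>
    obtain ⟨n, w, c, H⟩ := ih
    obtain ⟨e, rfl, he⟩ := h
    refine ⟨n + 1, fun i => Nat.casesOn i (Q.src e) w, fun i => Nat.casesOn i e c,
      ⟨rfl, H.finish, ?_, ?_⟩⟩
    · rintro (_ | i) hi
      · rfl
      · exact H.src i (by omega)
    · rintro (_ | i) hi
      · exact he.trans H.start.symm
      · exact H.tgt i (by omega)

theorem QuiverData.IsWalk.shortcut {Q : QuiverData} {x y : Fin Q.nV} {n : ℕ} {w : ℕ → Fin Q.nV}
    {c : ℕ → Fin Q.nE} (H : Q.IsWalk x y n w c) {i j : ℕ} (hij : i < j) (hj : j ≤ n)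
    (h : w i = w j) : ∃ w' c', Q.IsWalk x y (n - (j - i)) w' c' := by
  refine ⟨fun m => if m ≤ i then w m else w (m + (j - i)),
    fun m => if m < i then c m else c (m + (j - i)), ⟨?_, ?_, ?_, ?_⟩⟩
  · simp [H.start]
  · split_ifs with h'
    · have h1 : n - (j - i) = i := by omega
      have h2 : j = n := by omega
      rw [h1, h, h2, H.finish]
    · rw [Nat.sub_add_cancel (by omega), H.finish]
  · intro m hm
    split_ifs with h1 h2 h2
    · exact H.src m (by omega)
    · omega
    · obtain rfl : m = i := by omega
      rw [H.src _ (by omega), h]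
      congr 1; omega
    · exact H.src _ (by omega)
  · intro m hm
    split_ifs with h1 h2 h2
    · exact H.tgt m (by omega)
    · omega
    · omega
    · rw [H.tgt _ (by omega)]
      congr 1; omega

/-- An arrow lying on a closed directed walk lies on a cycle. -/
theorem exists_uCycle_of_reach {Q : QuiverData} (e : Fin Q.nE)
    (h : Relation.ReflTransGen Q.Step (Q.tgt e) (Q.src e)) :
    ∃ C : UCycle Q, e ∈ C.edgeSet := by
  classical
  have hex := QuiverData.exists_isWalk e h
  obtain ⟨w, c, H⟩ := Nat.find_spec hex
  set n := Nat.find hex with hn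
  have hlt : ∀ i j, i < j → j ≤ n → w i ≠ w j := by
    intro i j hij hj hw
    obtain ⟨w', c', H'⟩ := H.shortcut hij hj hw
    exact Nat.find_min hex (m := n - (j - i)) (by omega) ⟨w', c', H'⟩
  have hinj : ∀ i j, i < n + 1 → j < n + 1 → w i = w j → i = j := by
    intro i j hi hj hw
    rcases lt_trichotomy i j with h' | h' | h'
    · exact absurd hw (hlt i j h' (by omega))
    · exact h'
    · exact absurd hw.symm (hlt j i h' (by omega))
  let E : ℕ → Fin Q.nE := fun i => if i = n then e else c i
  have hsrc : ∀ i < n + 1, Q.src (E i) = w i := by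
    intro i hi
    by_cases h' : i = n
    · simp only [E, h', if_true, H.finish]
    · simp only [E, h', if_false]
      exact H.src i (by omega)
  have htgt : ∀ i, Q.tgt (E (i % (n + 1))) = w ((i + 1) % (n + 1)) := by
    intro i
    have hi : i % (n + 1) < n + 1 := Nat.mod_lt i (Nat.succ_pos n)
    by_cases h' : i % (n + 1) = n
    · have : (i + 1) % (n + 1) = 0 := by rw [Nat.add_mod, h']; simp
      simp only [E, h', if_true, this, H.start]
    · have : (i + 1) % (n + 1) = i % (n + 1) + 1 := by
        rw [Nat.add_mod, Nat.mod_eq_of_lt (a := 1) (by omega), Nat.mod_eq_of_lt (by omega)]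
      simp only [E, h', if_false, this]
      exact H.tgt _ (by omega)
  have hmod : ∀ i, i < n + 1 → i % (n + 1) = i := fun i hi => Nat.mod_eq_of_lt hi
  refine ⟨{
    len := n + 1
    len1 := by omega
    edges := fun i => E (i % (n + 1))
    dir := fun _ => true
    vert := fun i => w (i % (n + 1))
    pe := fun i => by rw [Nat.add_mod_right]
    pd := fun _ => rfl
    pv := fun i => by rw [Nat.add_mod_right]
    incid_t := fun i _ => ⟨hsrc _ (Nat.mod_lt i (Nat.succ_pos n)), htgt i⟩
    incid_f := fun _ h => absurd h (by decide)
    vdist := fun i j hi hj h => by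
      rw [hmod i hi, hmod j hj] at h
      exact hinj i j hi hj h
    edist := fun i j hi hj h => by
      rw [hmod i hi, hmod j hj] at h
      exact hinj i j hi hj (by rw [← hsrc i hi, ← hsrc j hj, h]) }, n, Nat.lt_succ_self n, ?_⟩
  change E (n % (n + 1)) = e
  simp [E, hmod n (Nat.lt_succ_self n)]

variable {k : Type} [Field k] {Q : QuiverData} {Rel : Set (Fin Q.nE × Fin Q.nE)}

theorem reach_of_path_ne_zero (b : Fin Q.nE) (M : List (Fin Q.nE)) (w : Fin Q.nV)
    (h : arrA k Q Rel b * (M.map (arrA k Q Rel)).prod * vtxA k Q Rel w ≠ 0) :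
    Relation.ReflTransGen Q.Step (Q.tgt b) w := by
  induction M generalizing b with
  | nil =>
    by_contra H
    apply h
    have : Q.tgt b ≠ w := fun h' => H (h' ▸ Relation.ReflTransGen.refl)
    rw [List.map_nil, List.prod_nil, mul_one, arrA_mul_vtxA_of_ne this]
  | cons c M ih =>
    rw [List.map_cons, List.prod_cons, ← mul_assoc] at h
    have hbc : Q.tgt b = Q.src c := by
      by_contra H
      rw [arrA_mul_arrA_of_ne H, zero_mul, zero_mul] at h
      exact h rfl
    refine Relation.ReflTransGen.head ⟨c, hbc.symm, rfl⟩ (ih c fun H => h ?_)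
    rw [mul_assoc, mul_assoc, ← mul_assoc (arrA k Q Rel c), H, mul_zero]

namespace FRCycle

variable (C : FRCycle k Q Rel)

theorem arrows_mod (i : ℕ) : C.arrows (i % C.len) = C.arrows i :=
  Function.Periodic.map_mod_nat C.periodic i

theorem len_pos : 0 < C.len := lt_of_lt_of_le (by norm_num) C.len3

theorem src_eq_iff (i j : ℕ) : Q.src (C.arrows i) = Q.src (C.arrows j) ↔ i ≡ j [MOD C.len] := by
  constructor
  · intro h
    rw [← C.arrows_mod i, ← C.arrows_mod j] at h
    exact C.vinj _ _ (Nat.mod_lt _ C.len_pos) (Nat.mod_lt _ C.len_pos) h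
  · intro h
    rw [← C.arrows_mod i, ← C.arrows_mod j, h]

theorem reach_add (i m : ℕ) :
    Relation.ReflTransGen Q.Step (Q.src (C.arrows i)) (Q.src (C.arrows (i + m))) := by
  induction m with
  | zero => exact Relation.ReflTransGen.refl
  | succ m ih => exact ih.tail ⟨C.arrows (i + m), rfl, C.comp _⟩

theorem reach (i j : ℕ) :
    Relation.ReflTransGen Q.Step (Q.src (C.arrows i)) (Q.src (C.arrows j)) := by
  have hlen := C.len_pos
  have hle : i ≤ j + C.len * i := le_trans (Nat.le_mul_of_pos_left i hlen) (Nat.le_add_left _ _)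
  have := C.reach_add i (j + C.len * i - i)
  rw [Nat.add_sub_cancel' hle] at this
  rwa [(C.src_eq_iff (j + C.len * i) j).2 (by simp [Nat.ModEq])] at this

theorem arrA_mul_arrA (i : ℕ) :
    arrA k Q Rel (C.arrows i) * arrA k Q Rel (C.arrows (i + 1)) = 0 :=
  inI_iff.1 (C.frel i)

/-- The arrows of the cycle, indexed by the integers. -/
def arrowsInt (i : ℤ) : Fin Q.nE := C.arrows (i % C.len).toNat

theorem arrowsInt_natCast (n : ℕ) : C.arrowsInt n = C.arrows n := by
  rw [arrowsInt, ← Int.natCast_mod, Int.toNat_natCast, arrows_mod]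

theorem exists_arrowsInt (i : ℤ) :
    ∃ n : ℕ, C.arrowsInt i = C.arrows n ∧ C.arrowsInt (i + 1) = C.arrows (n + 1) := by
  have hpos : (0 : ℤ) < C.len := by exact_mod_cast C.len_pos
  refine ⟨(i % C.len).toNat, rfl, ?_⟩
  rw [← arrowsInt_natCast, arrowsInt, arrowsInt]
  push_cast
  rw [Int.toNat_of_nonneg (Int.emod_nonneg _ hpos.ne'), Int.emod_add_emod]

end FRCycle

end Walks

/-! ### Annihilators of arrows in gentle algebras -/

section Gentle

variable {k : Type} [Field k] {Q : QuiverData} {Rel : Set (Fin Q.nE × Fin Q.nE)}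

theorem exists_eq_arrA_mul (hg : IsGentle k Q Rel) {a b : Fin Q.nE} (hab : Q.tgt a = Q.src b)
    (h0 : arrA k Q Rel a * arrA k Q Rel b = 0) {x : GAlg k Q Rel}
    (hx : vtxA k Q Rel (Q.tgt a) * x = x) (hax : arrA k Q Rel a * x = 0) :
    ∃ y, x = arrA k Q Rel b * y := by
  suffices h : x ∈ rIdeal _ (arrA k Q Rel b) from mem_rIdeal.1 h
  rw [← hx]
  conv => enter [2]; rw [eq_sum_words x, Finset.mul_sum]
  refine Submodule.sum_mem _ fun p hp => mem_rIdeal.2 ?_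
  have hcons : ¬ Word.CanCons Rel a p := by
    intro hc
    have := consArr_apply hc (toWords x)
    rw [← toWords_arrA_mul, hax, toWords_zero] at this
    exact Finsupp.mem_support_iff.1 hp this.symm
  rw [mul_smul_comm]
  by_cases hv : Q.tgt a = p.1
  · rw [Word.CanCons, not_and] at hcons
    have hcons := hcons hv
    push Not at hcons
    obtain ⟨c, hc, hr⟩ := hcons
    obtain ⟨L, hL⟩ := List.getLast?_eq_some_iff.1 hc
    have hcb : c = b := hg.uniq_rel_right a c b (hg.comp_rel _ hr) hab
      (inI_iff.2 (arrA_mul_arrA_of_rel hr)) (inI_iff.2 h0)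
    have hp' : p = (p.1, L ++ [c]) := Prod.ext rfl hL
    refine ⟨toWords x p • (L.reverse.map (arrA k Q Rel)).prod, ?_⟩
    rw [mul_smul_comm]
    congr 1
    rw [hp', Word.eval_append, hcb, ← hv, hab, vtxA_src_mul_arrA, ← mul_assoc, vtxA_src_mul_arrA]
  · exact ⟨0, by rw [Word.eval, ← mul_assoc, vtxA_mul_vtxA_of_ne hv, zero_mul, smul_zero, mul_zero]⟩

theorem exists_eq_mul_arrA (hg : IsGentle k Q Rel) {a b : Fin Q.nE} (hab : Q.tgt a = Q.src b)
    (h0 : arrA k Q Rel a * arrA k Q Rel b = 0) {x : GAlg k Q Rel}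
    (hx : x * vtxA k Q Rel (Q.src b) = x) (hxb : x * arrA k Q Rel b = 0) :
    ∃ y, x = y * arrA k Q Rel a := by
  suffices h : x ∈ Ideal.span {arrA k Q Rel a} by
    obtain ⟨y, hy⟩ := Ideal.mem_span_singleton'.1 h
    exact ⟨y, hy.symm⟩
  rw [← hx]
  conv => enter [2]; rw [eq_sum_words x, Finset.sum_mul]
  refine Submodule.sum_mem _ fun p hp => Ideal.mem_span_singleton'.2 ?_
  have hsnoc : ¬ Word.CanSnoc Rel p b := by
    intro hc
    have := snocArr_apply hc (toWords x)
    rw [← toWords_mul_arrA, hxb, toWords_zero] at this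
    exact Finsupp.mem_support_iff.1 hp this.symm
  rw [smul_mul_assoc, Word.eval_mul_vtxA]
  split_ifs with hv
  · rw [Word.CanSnoc, not_and] at hsnoc
    have hsnoc := hsnoc hv
    push Not at hsnoc
    obtain ⟨c, hc, hr⟩ := hsnoc
    obtain ⟨L, hL⟩ := List.head?_eq_some_iff.1 hc
    have hca : c = a := hg.uniq_rel_left b c a (hg.comp_rel _ hr) hab
      (inI_iff.2 (arrA_mul_arrA_of_rel hr)) (inI_iff.2 h0)
    have hp' : p = (p.1, c :: L) := Prod.ext rfl hL
    refine ⟨toWords x p • Word.eval k Rel (p.1, L), ?_⟩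
    rw [smul_mul_assoc]
    congr 1
    rw [hp', Word.eval_cons, hca]
  · exact ⟨0, by rw [zero_mul, smul_zero]⟩

theorem toWords_arrA_mul_apply (a : Fin Q.nE) (x : GAlg k Q Rel) :
    toWords (arrA k Q Rel a * x) (Q.src a, [a]) = toWords x (Q.tgt a, []) := by
  rw [toWords_arrA_mul]
  exact consArr_apply (p := (Q.tgt a, [])) ⟨rfl, by simp⟩ _

theorem not_projective_rIdeal_arrA {a b : Fin Q.nE} (hab : Q.tgt a = Q.src b)
    (h0 : arrA k Q Rel a * arrA k Q Rel b = 0) :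
    ¬ Module.Projective (GAlg k Q Rel)ᵐᵒᵖ (rIdeal (GAlg k Q Rel) (arrA k Q Rel a)) := by
  intro H
  let f : GAlg k Q Rel →ₗ[(GAlg k Q Rel)ᵐᵒᵖ] rIdeal (GAlg k Q Rel) (arrA k Q Rel a) :=
    (leftMul (arrA k Q Rel a)).codRestrict _ fun x => mem_rIdeal.2 ⟨x, rfl⟩
  have hf : Function.Surjective f := by
    rintro ⟨y, hy⟩
    obtain ⟨z, rfl⟩ := mem_rIdeal.1 hy
    exact ⟨z, rfl⟩
  obtain ⟨s, hs⟩ := Module.projective_lifting_property f LinearMap.id hf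
  set x := s ⟨arrA k Q Rel a, self_mem_rIdeal _⟩ with hx
  have hax : arrA k Q Rel a * x = arrA k Q Rel a :=
    congrArg Subtype.val (LinearMap.congr_fun hs ⟨arrA k Q Rel a, self_mem_rIdeal _⟩)
  have hxb : x * arrA k Q Rel b = 0 := by
    rw [hx, ← op_smul_eq_mul, ← map_smul]
    refine (congrArg s (Subtype.ext ?_)).trans (map_zero s)
    exact h0
  have h1 : toWords x (Q.tgt a, []) = 1 := by
    rw [← toWords_arrA_mul_apply, hax, toWords_arrA]
    simp
  have h2 := snocArr_apply (Rel := Rel) (p := (Q.tgt a, [])) (b := b) ⟨hab, by simp⟩ (toWords x)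
  rw [← toWords_mul_arrA, hxb, toWords_zero, h1] at h2
  exact zero_ne_one h2

theorem prod_eq_zero_of_le_length {m : ℕ} (hm : ∀ f : Fin m → Fin Q.nE,
    inI k Q Rel (List.ofFn fun i => arr k Q (f i)).prod) (L : List (Fin Q.nE))
    (hL : m ≤ L.length) : (L.map (arrA k Q Rel)).prod = 0 := by
  have h : ((L.take m).map (arrA k Q Rel)).prod = 0 := by
    have := hm fun i => L.get (Fin.castLE hL i)
    rw [inI, map_list_prod, List.map_ofFn] at this
    refine (congrArg List.prod ?_).trans this
    refine List.ext_getElem (by simp [hL]) fun i h₁ h₂ => ?_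
    simp [arrA]
  rw [← List.take_append_drop m L, List.map_append, List.prod_append, h, zero_mul]

open scoped Pointwise in
theorem isNilpotent_of_mem_span (hg : IsGentle k Q Rel) {j : GAlg k Q Rel}
    (hj : j ∈ Submodule.span k {x | ∃ L : List (Fin Q.nE), 1 ≤ L.length ∧
      x = (L.map (arrA k Q Rel)).prod}) : IsNilpotent j := by
  obtain ⟨m, -, hm⟩ := hg.admissible
  refine ⟨m, ?_⟩
  have h := Submodule.pow_mem_pow _ hj m
  rw [Submodule.span_pow] at h
  have hS : ∀ n, ∀ x ∈ {x | ∃ L : List (Fin Q.nE), 1 ≤ L.length ∧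
      x = (L.map (arrA k Q Rel)).prod} ^ n, ∃ L : List (Fin Q.nE), n ≤ L.length ∧
      x = (L.map (arrA k Q Rel)).prod := by
    intro n
    induction n with
    | zero =>
      intro x hx
      rw [pow_zero] at hx
      exact ⟨[], le_rfl, hx⟩
    | succ n ih =>
      intro x hx
      rw [pow_succ] at hx
      obtain ⟨y, hy, z, ⟨L', hL', rfl⟩, rfl⟩ := Set.mem_mul.1 hx
      obtain ⟨L, hL, rfl⟩ := ih y hy
      exact ⟨L ++ L', by rw [List.length_append]; omega, by simp⟩
  have hle : Submodule.span k ({x | ∃ L : List (Fin Q.nE), 1 ≤ L.length ∧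
      x = (L.map (arrA k Q Rel)).prod} ^ m) ≤ ⊥ := by
    rw [Submodule.span_le]
    intro x hx
    obtain ⟨L, hL, rfl⟩ := hS m x hx
    exact prod_eq_zero_of_le_length hm L hL
  exact (Submodule.mem_bot k).1 (hle h)

/-- Corner elements differ from a multiple of the idempotent by a combination of paths of
positive length. -/
theorem corner_sub_mem (x : GAlg k Q Rel) (v : Fin Q.nV) :
    vtxA k Q Rel v * x * vtxA k Q Rel v - toWords x (v, []) • vtxA k Q Rel v ∈
      Submodule.span k {x | ∃ L : List (Fin Q.nE), 1 ≤ L.length ∧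
        x = (L.map (arrA k Q Rel)).prod} := by
  classical
  have key : vtxA k Q Rel v * x * vtxA k Q Rel v = ∑ p ∈ insert (v, []) (toWords x).support,
      toWords x p • (vtxA k Q Rel v * p.eval k Rel * vtxA k Q Rel v) := by
    conv_lhs => rw [eq_sum_words x]
    rw [Finset.mul_sum, Finset.sum_mul]
    refine (Finset.sum_congr rfl fun p _ => by
      rw [mul_smul_comm, smul_mul_assoc]).trans ?_
    refine Finset.sum_subset (Finset.subset_insert _ _) fun p _ hp => ?_
    rw [Finsupp.notMem_support_iff.1 hp, zero_smul]
  have h0 : vtxA k Q Rel v * Word.eval k Rel (v, []) * vtxA k Q Rel v = vtxA k Q Rel v := by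
    simp [Word.eval, vtxA_mul_self]
  rw [key, ← Finset.add_sum_erase _ _ (Finset.mem_insert_self _ _), h0, add_sub_cancel_left]
  refine Submodule.sum_mem _ fun p hp => Submodule.smul_mem _ _ ?_
  have hne := (Finset.mem_erase.1 hp).1
  rcases p with ⟨u, L⟩
  rw [mul_assoc, Word.eval_mul_vtxA]
  split_ifs with hl
  swap
  · rw [mul_zero]
    exact Submodule.zero_mem _
  by_cases hu : v = u
  swap
  · rw [Word.eval, ← mul_assoc, vtxA_mul_vtxA_of_ne hu, zero_mul]
    exact Submodule.zero_mem _
  subst hu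
  rw [Word.eval, ← mul_assoc, vtxA_mul_self]
  rcases L.eq_nil_or_concat with rfl | ⟨L, c, rfl⟩
  · exact absurd rfl hne
  · by_cases hc : v = Q.src c
    · refine Submodule.subset_span ⟨c :: L.reverse, by simp, ?_⟩
      subst hc
      simp [← mul_assoc, vtxA_src_mul_arrA]
    · have : vtxA k Q Rel v * ((L ++ [c]).reverse.map (arrA k Q Rel)).prod = 0 := by
        simp [← mul_assoc, vtxA_mul_arrA_of_ne hc]
      simp only [List.concat_eq_append, this]
      exact Submodule.zero_mem _

theorem arrA_mem_of_coeff_ne_zero (hg : IsGentle k Q Rel) {a : Fin Q.nE}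
    {N : Submodule (GAlg k Q Rel)ᵐᵒᵖ (GAlg k Q Rel)} {x : GAlg k Q Rel}
    (hN : arrA k Q Rel a * x ∈ N) (hx : toWords x (Q.tgt a, []) ≠ 0) : arrA k Q Rel a ∈ N := by
  set c := toWords x (Q.tgt a, []) with hc
  set v := vtxA k Q Rel (Q.tgt a) with hv
  set j := v * x * v - c • v with hj
  have hnil : IsNilpotent j := isNilpotent_of_mem_span hg (corner_sub_mem x (Q.tgt a))
  have hunit : IsUnit (algebraMap k (GAlg k Q Rel) c + j) :=
    hnil.isUnit_add_left_of_commute ((isUnit_iff_ne_zero.2 hx).map _)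
      (Algebra.commutes c j).symm
  obtain ⟨u, hu⟩ := hunit
  have hav : arrA k Q Rel a * v = arrA k Q Rel a := arrA_mul_vtxA_tgt a
  have h1 : arrA k Q Rel a * x * v = arrA k Q Rel a * u := by
    have h2 : v * x * v = j + c • v := by rw [hj, sub_add_cancel]
    calc arrA k Q Rel a * x * v = arrA k Q Rel a * (v * x * v) := by
          rw [← mul_assoc, ← mul_assoc, hav]
      _ = arrA k Q Rel a * u := by
          rw [h2, hu, mul_add, mul_add, mul_smul_comm, hav, add_comm, ← Algebra.commutes,
            Algebra.smul_def]
  have h3 : arrA k Q Rel a = arrA k Q Rel a * x * (v * ↑u⁻¹) := by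
    rw [← mul_assoc, h1, mul_assoc, Units.mul_inv, mul_one]
  rw [h3]
  exact N.smul_mem (op (v * ↑u⁻¹)) hN

theorem isIndec_rIdeal_arrA (hg : IsGentle k Q Rel) (a : Fin Q.nE) :
    IsIndec (GAlg k Q Rel)ᵐᵒᵖ (rIdeal (GAlg k Q Rel) (arrA k Q Rel a)) := by
  have hone : toWords (arrA k Q Rel a) (Q.src a, [a]) = 1 := by
    rw [toWords_arrA]; simp
  refine isIndec_of_mem (fun h => ?_) fun N₁ N₂ n₁ h₁ n₂ h₂ hN₁ hN₂ hn => ?_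
  · rw [h, toWords_zero] at hone
    exact zero_ne_one hone
  · obtain ⟨x₁, rfl⟩ := mem_rIdeal.1 (hN₁ h₁)
    obtain ⟨x₂, rfl⟩ := mem_rIdeal.1 (hN₂ h₂)
    rw [← hn, toWords_add, Finsupp.add_apply, toWords_arrA_mul_apply,
      toWords_arrA_mul_apply] at hone
    by_cases h : toWords x₁ (Q.tgt a, []) = 0
    · right
      refine arrA_mem_of_coeff_ne_zero hg h₂ fun h' => ?_
      rw [h, h', add_zero] at hone
      exact zero_ne_one hone
    · exact Or.inl (arrA_mem_of_coeff_ne_zero hg h₁ h)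

theorem isNPIGProj_rIdeal_arrA (hg : IsGentle k Q Rel) (C : FRCycle k Q Rel) (t : ℕ) :
    IsNPIGProj (GAlg k Q Rel) (rIdeal (GAlg k Q Rel) (arrA k Q Rel (C.arrows t))) := by
  refine ⟨?_, isIndec_rIdeal_arrA hg _,
    not_projective_rIdeal_arrA (C.comp t) (C.arrA_mul_arrA t)⟩
  have htgt : ∀ i, Q.tgt (C.arrowsInt i) = Q.src (C.arrowsInt (i + 1)) := by
    intro i
    obtain ⟨n, h₁, h₂⟩ := C.exists_arrowsInt i
    rw [h₁, h₂, C.comp]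
  have hzero : ∀ i, arrA k Q Rel (C.arrowsInt i) * arrA k Q Rel (C.arrowsInt (i + 1)) = 0 := by
    intro i
    obtain ⟨n, h₁, h₂⟩ := C.exists_arrowsInt i
    rw [h₁, h₂, C.arrA_mul_arrA]
  have := isGProjMod_rIdeal (fun i => vtxA k Q Rel (Q.src (C.arrowsInt i)))
    (fun i => arrA k Q Rel (C.arrowsInt i)) (fun i => vtxA_mul_self _)
    (fun i => vtxA_src_mul_arrA _) (fun i => by rw [← htgt, arrA_mul_vtxA_tgt]) hzero
    (fun i x h₁ h₂ => exists_eq_arrA_mul hg (htgt i) (hzero i) (by rwa [htgt]) h₂)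
    (fun i x h₁ h₂ => exists_eq_mul_arrA hg (htgt i) (hzero i) h₁ h₂) t
  rwa [C.arrowsInt_natCast] at this

theorem arrA_mul_mul_epsCt (C : FRCycle k Q Rel)
    (hc : ∀ C' : UCycle Q, C'.edgeSet = C.arrowSet) (t : ℕ) (x : GAlg k Q Rel) :
    arrA k Q Rel (C.arrows t) * x * epsCt k Q Rel C t = 0 := by
  rw [epsCt, Finset.mul_sum]
  refine Finset.sum_eq_zero fun i hi => ?_
  obtain ⟨-, -, hi⟩ := Finset.mem_filter.1 hi
  conv_lhs => rw [eq_sum_words x]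
  rw [Finset.mul_sum, Finset.sum_mul]
  refine Finset.sum_eq_zero fun p _ => ?_
  rw [mul_smul_comm, smul_mul_assoc]
  refine smul_eq_zero_of_right _ ?_
  rcases p with ⟨v, L⟩
  by_cases hv : Q.tgt (C.arrows t) = v
  swap
  · rw [Word.eval, ← mul_assoc, arrA_mul_vtxA_of_ne hv, zero_mul, zero_mul]
  rcases L.eq_nil_or_concat with rfl | ⟨L, b, rfl⟩
  · rw [mul_assoc, Word.eval_mul_vtxA, if_neg, mul_zero]
    exact fun h => hi (h.symm.trans hv.symm)
  rw [List.concat_eq_append, Word.eval_append]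
  by_cases hb : v = Q.src b
  swap
  · rw [vtxA_mul_arrA_of_ne hb, zero_mul, mul_zero, zero_mul]
  rw [hb, vtxA_src_mul_arrA]
  by_contra hne
  have hreach : Relation.ReflTransGen Q.Step (Q.tgt b) (Q.src (C.arrows i)) :=
    reach_of_path_ne_zero (k := k) (Rel := Rel) b L.reverse _ fun h => hne (by
      rw [mul_assoc, h, mul_zero])
  have hsrc : Q.src b = Q.src (C.arrows (t + 1)) := by rw [← hb, ← hv, C.comp]
  obtain ⟨C', hC'⟩ := exists_uCycle_of_reach b (hreach.trans (hsrc ▸ C.reach i (t + 1)))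
  rw [hc C'] at hC'
  obtain ⟨m, -, rfl⟩ := hC'
  have hm : C.arrows m = C.arrows (t + 1) := by
    rw [← C.arrows_mod m, ← C.arrows_mod (t + 1), (C.src_eq_iff m (t + 1)).1 hsrc]
  apply hne
  rw [hm, ← mul_assoc, C.arrA_mul_arrA, zero_mul, zero_mul]

theorem vtxA_mul_epsCt (C : FRCycle k Q Rel) (t : ℕ) :
    vtxA k Q Rel (Q.src (C.arrows (t + 2))) * epsCt k Q Rel C t =
      vtxA k Q Rel (Q.src (C.arrows (t + 2))) := by
  have hlen := C.len3
  have hne : ∀ i d, 0 < d → d < 3 → Q.src (C.arrows (i + d)) ≠ Q.src (C.arrows i) := by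
    intro i d hd hd3 h
    have h' : i + d ≡ i + 0 [MOD C.len] := (C.src_eq_iff _ _).1 h
    have := Nat.le_of_dvd hd (Nat.modEq_zero_iff_dvd.1 (Nat.ModEq.add_left_cancel' i h'))
    omega
  rw [epsCt, Finset.mul_sum, Finset.sum_eq_single ((t + 2) % C.len)]
  · rw [C.arrows_mod, vtxA_mul_self]
  · intro i hi hne'
    refine vtxA_mul_vtxA_of_ne fun h => hne' ?_
    have := (C.src_eq_iff _ _).1 h
    rw [Nat.ModEq, Nat.mod_eq_of_lt (Finset.mem_range.1 (Finset.mem_filter.1 hi).1)] at this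
    exact this.symm
  · intro h
    refine absurd (Finset.mem_filter.2
      ⟨Finset.mem_range.2 (Nat.mod_lt _ C.len_pos), ?_, ?_⟩) h
    · rw [C.arrows_mod]
      exact hne t 2 (by norm_num) (by norm_num)
    · rw [C.arrows_mod, C.comp]
      exact hne (t + 1) 1 (by norm_num) (by norm_num)

theorem qmap_vtxA_mul_eq_zero_iff (hg : IsGentle k Q Rel) (C : FRCycle k Q Rel)
    (hc : ∀ C' : UCycle Q, C'.edgeSet = C.arrowSet) (t : ℕ) (x : GAlg k Q Rel) :
    qmap (GAlg k Q Rel) (epsCt k Q Rel C t) (vtxA k Q Rel (Q.tgt (C.arrows t)) * x) = 0 ↔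
      arrA k Q Rel (C.arrows t) * x = 0 := by
  have hav := arrA_mul_vtxA_tgt (k := k) (Rel := Rel) (C.arrows t)
  constructor
  · intro h
    have := annihilates_of_qmap_eq_zero (arrA_mul_mul_epsCt C hc t) h
    rwa [← mul_assoc, hav] at this
  · intro h
    obtain ⟨y, hy⟩ := exists_eq_arrA_mul hg (C.comp t) (C.arrA_mul_arrA t)
      (x := vtxA k Q Rel (Q.tgt (C.arrows t)) * x)
      (by rw [← mul_assoc, vtxA_mul_self]) (by rw [← mul_assoc, hav, h])
    have hb := arrA_mul_vtxA_tgt (k := k) (Rel := Rel) (C.arrows (t + 1))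
    rw [C.comp, ← vtxA_mul_epsCt C t] at hb
    rw [hy, ← hb, map_mul, map_mul, map_mul, qmap_eps, mul_zero, mul_zero, zero_mul]

end Gentle

/-- Theorem `thm:main 2` (3).  Let `A = kQ/I` be a gentle
one-cycle algebra whose unique cycle `𝒞 = a_1 ⋯ a_l` is a full-relational
oriented cycle, `t < l`.  Then `𝔢_{𝒞,t}(T_{𝒞,t}(a_tA))`, i.e. the projective
right `Ā_{𝒞,t}`-module `ε̄_{t(a_t)} Ā_{𝒞,t}` viewed as a right `A`-module along
`A → Ā_{𝒞,t}`, is isomorphic to `a_tA`;  in particular it is a non-projective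
indecomposable Gorenstein projective right `A`-module. -/
theorem stmt12 (k : Type) [Field k] [IsAlgClosed k] (Q : QuiverData)
    (Rel : Set (Fin Q.nE × Fin Q.nE)) (hgentle : IsGentle k Q Rel)
    (hfd : Module.Finite k (GAlg k Q Rel)) (hns : NoShortFRC k Q Rel)
    (C : FRCycle k Q Rel) (honecycle : ∀ C' : UCycle Q, C'.edgeSet = C.arrowSet)
    (t : ℕ) (ht : t < C.len) :
    let A := GAlg k Q Rel
    let ε := epsCt k Q Rel C t
    let Abar := QuotBy A ε
    let π := qmap A ε
    let P := ↥(rIdeal Abar (π (vtxA k Q Rel (Q.tgt (C.arrows t)))))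
    (letI := modRestrict π P;
      Nonempty (P ≃ₗ[Aᵐᵒᵖ] ↥(rIdeal A (arrA k Q Rel (C.arrows t))))) ∧
    RestrIsNPIGProj π P := by
  intro A ε Abar π P
  have h := nonempty_equiv_rIdeal (qmap_vtxA_mul_eq_zero_iff hgentle C honecycle t)
  refine ⟨h, ?_⟩
  let _ := modRestrict π P
  obtain ⟨f⟩ := h
  exact IsNPIGProj.of_equiv f (isNPIGProj_rIdeal_arrA hgentle C t)
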